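/- arXiv:0708.2669 — 7 statements merged into one kernel-verified Lean document; each statement's English description precedes it below -/
import Mathlib

section
/- Let $E$ be a finite-dimensional complex inner product space and $S : E \to E$ a linear operator. Then the subspace $\mathcal{L}_S := \{((\mathbf{1}+S)x,\, -i(\mathbf{1}-S)x) : x \in E\}$ of $E \oplus E$ is a hermitian lagrangian subspace (i.e. $\mathcal{L}_S^{\perp} = J\,\mathcal{L}_S$) if and only if $S$ is unitary. -/
noncomputable section

variable (E : Type*) [NormedAddCommGroup E] [InnerProductSpace ℂ E] [FiniteDimensional ℂ E]

/-- The hermitian symplectic space `Ê = E ⊕ E` with the direct-sum hermitian inner product. -/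
abbrev Ehat := WithLp 2 (E × E)

variable {E}

/-- The canonical linear identification `E × E ≃ Ê`. -/
def toHat : (E × E) ≃ₗ[ℂ] Ehat E := (WithLp.linearEquiv 2 ℂ (E × E)).symm

/-- The operator `J(x, y) = (-y, x)` on `Ê = E ⊕ E`. -/
def Jop : Ehat E →ₗ[ℂ] Ehat E :=
  toHat.toLinearMap ∘ₗ
    (LinearMap.prod (-(LinearMap.snd ℂ E E)) (LinearMap.fst ℂ E E)) ∘ₗ
      toHat.symm.toLinearMap

/-- A complex subspace `L ⊆ Ê` is a hermitian lagrangian subspace if `L^⊥ = J L`. -/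
def IsHermitianLagrangian (L : Submodule ℂ (Ehat E)) : Prop :=
  Lᗮ = L.map Jop

/-- `ℒ_S = {((1+S)x, -i(1-S)x) : x ∈ E} ⊆ E ⊕ E`. -/
def LagS (S : E →ₗ[ℂ] E) : Submodule ℂ (Ehat E) :=
  LinearMap.range (toHat.toLinearMap ∘ₗ
    LinearMap.prod (1 + S) ((-Complex.I) • (1 - S)))

/-- The parametrization `x ↦ ((1+S)x, -i(1-S)x)` of `ℒ_S`. -/
def lagSMap (S : E →ₗ[ℂ] E) : E →ₗ[ℂ] Ehat E :=
  toHat.toLinearMap ∘ₗ LinearMap.prod (1 + S) ((-Complex.I) • (1 - S))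

theorem lagSMap_injective {F : Type*} [NormedAddCommGroup F] [InnerProductSpace ℂ F]
    (S : F →ₗ[ℂ] F) : Function.Injective (lagSMap S) := by
  rw [← LinearMap.ker_eq_bot, LinearMap.ker_eq_bot']
  intro x hx
  have hpair : ((x + S x, (-Complex.I) • (x - S x)) : F × F) = 0 :=
    toHat.map_eq_zero_iff.mp hx
  have hadd : x + S x = 0 := congrArg Prod.fst hpair
  have hsub : x - S x = 0 :=
    (smul_eq_zero.mp (congrArg Prod.snd hpair)).resolve_left (neg_ne_zero.mpr Complex.I_ne_zero)
  have htwo : (2 : ℂ) • x = 0 := by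
    rw [two_smul]
    calc x + x = (x + S x) + (x - S x) := by abel
      _ = 0 := by rw [hadd, hsub, add_zero]
  exact (smul_eq_zero.mp htwo).resolve_left two_ne_zero

theorem Jop_injective {F : Type*} [NormedAddCommGroup F] [InnerProductSpace ℂ F] :
    Function.Injective (Jop (E := F)) := by
  rw [← LinearMap.ker_eq_bot, LinearMap.ker_eq_bot']
  intro v hv
  have hpair : ((-(toHat.symm v).2, (toHat.symm v).1) : F × F) = 0 :=
    toHat.map_eq_zero_iff.mp hv
  have hsnd : (toHat.symm v).2 = 0 := neg_eq_zero.mp (congrArg Prod.fst hpair)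
  have hfst : (toHat.symm v).1 = 0 := congrArg Prod.snd hpair
  exact toHat.symm.map_eq_zero_iff.mp (Prod.ext hfst hsnd)

theorem inner_lagSMap_Jop_lagSMap {F : Type*} [NormedAddCommGroup F] [InnerProductSpace ℂ F]
    (S : F →ₗ[ℂ] F) (x y : F) :
    inner ℂ (lagSMap S x) (Jop (lagSMap S y)) =
      2 * Complex.I * (inner ℂ x y - inner ℂ (S x) (S y)) := by
  have h : inner ℂ (lagSMap S x) (Jop (lagSMap S y)) =
      inner ℂ (x + S x) (-((-Complex.I) • (y - S y))) +
        inner ℂ ((-Complex.I) • (x - S x)) (y + S y) := rfl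
  rw [h]
  simp only [neg_smul, neg_neg, inner_smul_right, inner_neg_left, inner_smul_left,
    Complex.conj_I, inner_add_left, inner_add_right, inner_sub_left, inner_sub_right]
  ring

/-- Since `J ℒ_S` and `ℒ_S^⊥` have the same dimension, isotropy of `ℒ_S` suffices. -/
theorem lagS_isHermitianLagrangian_iff_map_le (S : E →ₗ[ℂ] E) :
    IsHermitianLagrangian (LagS S) ↔ (LagS S).map Jop ≤ (LagS S)ᗮ := by
  refine ⟨fun h => h.ge, fun h => (Submodule.eq_of_le_of_finrank_eq h ?_).symm⟩
  have hL : Module.finrank ℂ (LagS S) = Module.finrank ℂ E :=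
    LinearMap.finrank_range_of_inj (lagSMap_injective S)
  have hE : Module.finrank ℂ (Ehat E) = Module.finrank ℂ E + Module.finrank ℂ E := by
    rw [← (toHat (E := E)).finrank_eq, Module.finrank_prod]
  have hperp := (LagS S).finrank_add_finrank_orthogonal
  rw [((LagS S).equivMapOfInjective Jop Jop_injective).finrank_eq.symm]
  omega

theorem lagS_map_Jop_le_orthogonal_iff {F : Type*} [NormedAddCommGroup F] [InnerProductSpace ℂ F]
    (S : F →ₗ[ℂ] F) :
    (LagS S).map Jop ≤ (LagS S)ᗮ ↔ ∀ x y, inner ℂ (S x) (S y) = inner ℂ x y := by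
  have h : (LagS S).map Jop ≤ (LagS S)ᗮ ↔
      ∀ x y, inner ℂ (lagSMap S x) (Jop (lagSMap S y)) = 0 := by
    constructor
    · intro h x y
      exact h (Submodule.mem_map_of_mem ⟨y, rfl⟩) _ ⟨x, rfl⟩
    · rintro h _ ⟨_, ⟨y, rfl⟩, rfl⟩ _ ⟨x, rfl⟩
      exact h x y
  rw [h]
  refine forall₂_congr fun x y => ?_
  rw [inner_lagSMap_Jop_lagSMap]
  simp only [mul_eq_zero, OfNat.ofNat_ne_zero, Complex.I_ne_zero, false_or, sub_eq_zero]
  exact eq_comm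

theorem mem_unitary_iff_inner_map_map (S : E →ₗ[ℂ] E) :
    S ∈ unitary (E →ₗ[ℂ] E) ↔ ∀ x y, inner ℂ (S x) (S y) = inner ℂ x y := by
  rw [Unitary.mem_iff, mul_eq_one_comm (a := S), and_self, LinearMap.star_eq_adjoint]
  constructor
  · intro h x y
    rw [← LinearMap.adjoint_inner_left, ← Module.End.mul_apply, h, Module.End.one_apply]
  · intro h
    refine LinearMap.ext fun x => ext_inner_right ℂ fun y => ?_
    rw [Module.End.mul_apply, LinearMap.adjoint_inner_left, h, Module.End.one_apply]

/-- For a linear operator `S : E → E` on a finite-dimensional complex inner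
product space, the subspace `ℒ_S = {((1+S)x, -i(1-S)x) : x ∈ E}` of `E ⊕ E` is a hermitian
lagrangian subspace if and only if `S` is unitary. -/
theorem lagS_isHermitianLagrangian_iff_unitary (S : E →ₗ[ℂ] E) :
    IsHermitianLagrangian (LagS S) ↔ S ∈ unitary (E →ₗ[ℂ] E) := by
  rw [lagS_isHermitianLagrangian_iff_map_le, lagS_map_Jop_le_orthogonal_iff,
    mem_unitary_iff_inner_map_map]
end
end

section
/- The map $S \mapsto \mathcal{L}_S$, where $\mathcal{L}_S := \{((\mathbf{1}+S)x,\, -i(\mathbf{1}-S)x) : x \in E\}$, is a bijection from the group of unitary operators on $E$ onto the set of hermitian lagrangian subspaces of $E \oplus E$. -/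
noncomputable section

variable (E : Type*) [NormedAddCommGroup E] [InnerProductSpace ℂ E] [FiniteDimensional ℂ E]

variable {E}

/-- The component `(a, b) ↦ a + i b` of `Ê`, on which `J` acts as `i`. -/
def hatPlus : Ehat E →ₗ[ℂ] E :=
  (LinearMap.fst ℂ E E + Complex.I • LinearMap.snd ℂ E E) ∘ₗ toHat.symm.toLinearMap

/-- The component `(a, b) ↦ a - i b` of `Ê`, on which `J` acts as `-i`. -/
def hatMinus : Ehat E →ₗ[ℂ] E :=
  (LinearMap.fst ℂ E E - Complex.I • LinearMap.snd ℂ E E) ∘ₗ toHat.symm.toLinearMap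

omit [FiniteDimensional ℂ E] in
theorem hatPlus_toHat (a b : E) : hatPlus (toHat (a, b)) = a + Complex.I • b := by
  simp [hatPlus]

omit [FiniteDimensional ℂ E] in
theorem hatMinus_toHat (a b : E) : hatMinus (toHat (a, b)) = a - Complex.I • b := by
  simp [hatMinus]

omit [FiniteDimensional ℂ E] in
theorem Jop_toHat (a b : E) : Jop (toHat (a, b)) = toHat (-b, a) := by
  simp [Jop]

omit [FiniteDimensional ℂ E] in
theorem inner_toHat (a b c d : E) :
    inner ℂ (toHat (a, b)) (toHat (c, d)) = inner ℂ a c + inner ℂ b d := by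
  simp [toHat, WithLp.prod_inner_apply]

omit [FiniteDimensional ℂ E] in
theorem exists_hatPlus_hatMinus (x y : E) :
    ∃ v : Ehat E, hatPlus v = x ∧ hatMinus v = y := by
  refine ⟨toHat ((1 / 2 : ℂ) • (x + y), (-Complex.I / 2) • (x - y)), ?_, ?_⟩
  · rw [hatPlus_toHat, smul_smul,
      show Complex.I * (-Complex.I / 2) = 1 / 2 by linear_combination (-1 / 2) * Complex.I_sq]
    module
  · rw [hatMinus_toHat, smul_smul,
      show Complex.I * (-Complex.I / 2) = 1 / 2 by linear_combination (-1 / 2) * Complex.I_sq]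
    module

omit [FiniteDimensional ℂ E] in
theorem ext_hatPlus_hatMinus {u v : Ehat E} (hp : hatPlus u = hatPlus v)
    (hm : hatMinus u = hatMinus v) : u = v := by
  obtain ⟨⟨a, b⟩, rfl⟩ := toHat.surjective u
  obtain ⟨⟨c, d⟩, rfl⟩ := toHat.surjective v
  rw [hatPlus_toHat, hatPlus_toHat] at hp
  rw [hatMinus_toHat, hatMinus_toHat] at hm
  have hac : a = c := by
    linear_combination (norm := module) (1 / 2 : ℂ) • hp + (1 / 2 : ℂ) • hm
  have hbd : b = d := by
    subst hac
    exact smul_right_injective E Complex.I_ne_zero (add_left_cancel hp)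
  rw [hac, hbd]

omit [FiniteDimensional ℂ E] in
theorem inner_Jop (u v : Ehat E) :
    2 * Complex.I * inner ℂ v (Jop u) =
      inner ℂ (hatMinus v) (hatMinus u) - inner ℂ (hatPlus v) (hatPlus u) := by
  obtain ⟨⟨a, b⟩, rfl⟩ := toHat.surjective u
  obtain ⟨⟨c, d⟩, rfl⟩ := toHat.surjective v
  simp only [Jop_toHat, inner_toHat, hatPlus_toHat, hatMinus_toHat, inner_add_left,
    inner_add_right, inner_sub_left, inner_sub_right, inner_smul_left, inner_smul_right,
    inner_neg_right, Complex.conj_I]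
  ring

omit [FiniteDimensional ℂ E] in
theorem inner_Jop_eq_zero_iff (u v : Ehat E) :
    inner ℂ v (Jop u) = 0 ↔
      inner ℂ (hatPlus v) (hatPlus u) = inner ℂ (hatMinus v) (hatMinus u) := by
  rw [eq_comm (a := inner ℂ (hatPlus v) _), ← sub_eq_zero (b := inner ℂ (hatPlus v) _),
    ← inner_Jop]
  simp

omit [FiniteDimensional ℂ E] in
theorem Jop_Jop (u : Ehat E) : Jop (Jop u) = -u := by
  obtain ⟨⟨a, b⟩, rfl⟩ := toHat.surjective u
  rw [Jop_toHat, Jop_toHat, ← map_neg, Prod.neg_mk]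

omit [FiniteDimensional ℂ E] in
theorem isHermitianLagrangian_iff (L : Submodule ℂ (Ehat E)) :
    IsHermitianLagrangian L ↔ ∀ u, u ∈ L ↔
      ∀ v ∈ L, inner ℂ (hatPlus v) (hatPlus u) = inner ℂ (hatMinus v) (hatMinus u) := by
  have hJ : Function.Bijective (Jop : Ehat E → Ehat E) := by
    refine ⟨fun u v h => ?_, fun u => ⟨-Jop u, by rw [map_neg, Jop_Jop, neg_neg]⟩⟩
    simpa [Jop_Jop] using congrArg Jop h
  simp only [← inner_Jop_eq_zero_iff, ← Submodule.mem_orthogonal]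
  rw [IsHermitianLagrangian, SetLike.ext_iff, hJ.surjective.forall]
  refine forall_congr' fun u => ?_
  rw [← SetLike.mem_coe (p := L.map Jop), Submodule.map_coe, hJ.injective.mem_set_image,
    SetLike.mem_coe, iff_comm (a := u ∈ L)]

omit [FiniteDimensional ℂ E] in
theorem mem_LagS_iff (S : E →ₗ[ℂ] E) (u : Ehat E) :
    u ∈ LagS S ↔ hatMinus u = S (hatPlus u) := by
  have hI : Complex.I * -Complex.I = 1 := by linear_combination -Complex.I_sq
  have hp (x : E) : hatPlus (toHat ((1 + S) x, ((-Complex.I) • (1 - S)) x)) = (2 : ℂ) • x := by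
    rw [hatPlus_toHat, LinearMap.smul_apply, smul_smul, hI, LinearMap.add_apply,
      LinearMap.sub_apply, Module.End.one_apply]
    module
  have hm (x : E) :
      hatMinus (toHat ((1 + S) x, ((-Complex.I) • (1 - S)) x)) = (2 : ℂ) • S x := by
    rw [hatMinus_toHat, LinearMap.smul_apply, smul_smul, hI, LinearMap.add_apply,
      LinearMap.sub_apply, Module.End.one_apply]
    module
  constructor
  · rintro ⟨x, rfl⟩
    exact (hm x).trans ((map_smul S 2 x).symm.trans (congrArg S (hp x).symm))
  · intro h
    refine ⟨(1 / 2 : ℂ) • hatPlus u, ext_hatPlus_hatMinus ((hp _).trans ?_) ((hm _).trans ?_)⟩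
    · module
    · rw [h, map_smul]
      module

theorem mem_unitary_of_inner_map_map {S : E →ₗ[ℂ] E}
    (h : ∀ x y, inner ℂ (S x) (S y) = inner ℂ x y) : S ∈ unitary (E →ₗ[ℂ] E) := by
  have hS : star S * S = 1 := by
    refine LinearMap.ext fun x => ext_inner_left ℂ fun y => ?_
    rw [LinearMap.star_eq_adjoint, Module.End.mul_apply, LinearMap.adjoint_inner_right, h,
      Module.End.one_apply]
  exact ⟨hS, mul_eq_one_comm.mp hS⟩

theorem isHermitianLagrangian_LagS {S : E →ₗ[ℂ] E} (hS : S ∈ unitary (E →ₗ[ℂ] E)) :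
    IsHermitianLagrangian (LagS S) := by
  have hl (x : E) : S.adjoint (S x) = x := LinearMap.congr_fun hS.1 x
  have hr (x : E) : S (S.adjoint x) = x := LinearMap.congr_fun hS.2 x
  rw [isHermitianLagrangian_iff]
  intro u
  constructor
  · intro hu v hv
    rw [mem_LagS_iff] at hu hv
    rw [hu, hv, ← LinearMap.adjoint_inner_right S, hl]
  · intro h
    have hu : hatPlus u = S.adjoint (hatMinus u) := by
      refine ext_inner_left ℂ fun x => ?_
      obtain ⟨v, rfl, hv⟩ := exists_hatPlus_hatMinus x (S x)
      rw [h v ((mem_LagS_iff S v).mpr hv), hv, LinearMap.adjoint_inner_right]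
    rw [mem_LagS_iff, hu, hr]

omit [FiniteDimensional ℂ E] in
theorem LagS_injective : Function.Injective (LagS : (E →ₗ[ℂ] E) → Submodule ℂ (Ehat E)) := by
  intro S T h
  ext x
  obtain ⟨v, rfl, hv⟩ := exists_hatPlus_hatMinus x (S x)
  have hvT : v ∈ LagS T := h ▸ (mem_LagS_iff S v).mpr hv
  rw [← hv, (mem_LagS_iff T v).mp hvT]

theorem IsHermitianLagrangian.exists_eq_LagS {L : Submodule ℂ (Ehat E)}
    (hL : IsHermitianLagrangian L) : ∃ S ∈ unitary (E →ₗ[ℂ] E), LagS S = L := by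
  rw [isHermitianLagrangian_iff] at hL
  have hinner {u v : Ehat E} (hu : u ∈ L) (hv : v ∈ L) :
      inner ℂ (hatPlus v) (hatPlus u) = inner ℂ (hatMinus v) (hatMinus u) := (hL u).mp hu v hv
  have hinj : Function.Injective (hatPlus.domRestrict L) := by
    rw [injective_iff_map_eq_zero]
    rintro ⟨v, hv⟩ hp
    replace hp : hatPlus v = 0 := hp
    have hm : hatMinus v = 0 := by
      rw [← inner_self_eq_zero (𝕜 := ℂ), ← hinner hv hv, hp, inner_zero_left]
    exact Subtype.ext (ext_hatPlus_hatMinus (by rw [hp]; simp) (by rw [hm]; simp))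
  have hsurj : Function.Surjective (hatPlus.domRestrict L) := by
    rw [← LinearMap.range_eq_top, ← Submodule.orthogonal_eq_bot_iff, Submodule.eq_bot_iff]
    intro y hy
    obtain ⟨u, rfl, hu⟩ := exists_hatPlus_hatMinus y 0
    have huL : u ∈ L := by
      refine (hL u).mpr fun v hv => ?_
      rw [hu, inner_zero_right]
      exact (Submodule.mem_orthogonal _ _).mp hy _ ⟨⟨v, hv⟩, rfl⟩
    rw [← inner_self_eq_zero (𝕜 := ℂ), hinner huL huL, hu, inner_zero_left]
  let e : L ≃ₗ[ℂ] E := LinearEquiv.ofBijective _ ⟨hinj, hsurj⟩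
  let S : E →ₗ[ℂ] E := hatMinus.domRestrict L ∘ₗ e.symm.toLinearMap
  have hS (v : L) : S (hatPlus (v : Ehat E)) = hatMinus (v : Ehat E) :=
    congrArg (hatMinus.domRestrict L) (e.symm_apply_apply v)
  refine ⟨S, mem_unitary_of_inner_map_map fun x y => ?_, Submodule.ext fun u => ?_⟩
  · obtain ⟨v, rfl⟩ := hsurj x
    obtain ⟨w, rfl⟩ := hsurj y
    rw [LinearMap.domRestrict_apply, LinearMap.domRestrict_apply, hS, hS, hinner w.2 v.2]
  · rw [mem_LagS_iff]
    refine ⟨fun hu => ?_, fun hu => (hS ⟨u, hu⟩).symm⟩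
    obtain ⟨v, hv⟩ := hsurj (hatPlus u)
    rw [LinearMap.domRestrict_apply] at hv
    rw [← hv, hS] at hu
    exact ext_hatPlus_hatMinus hv hu.symm ▸ v.2

/-- The map `S ↦ ℒ_S` is a bijection from the group of unitary operators on
`E` onto the set of hermitian lagrangian subspaces of `E ⊕ E`. -/
theorem bijOn_lagS :
    Set.BijOn (fun S : E →ₗ[ℂ] E => LagS S)
      (unitary (E →ₗ[ℂ] E) : Set (E →ₗ[ℂ] E))
      {L : Submodule ℂ (Ehat E) | IsHermitianLagrangian L} :=
  ⟨fun _ hS => isHermitianLagrangian_LagS hS, LagS_injective.injOn,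
    fun _ hL => IsHermitianLagrangian.exists_eq_LagS hL⟩
end
end

section
/- For a unitary operator $S$ on a finite-dimensional complex inner product space $E$, the orthogonal projection $P_{\mathcal{L}_S}$ of $E \oplus E$ onto the hermitian lagrangian $\mathcal{L}_S$ is given in block form by $P_{\mathcal{L}_S} = \frac{1}{2}\begin{pmatrix} \mathbf{1} + \frac{1}{2}(S+S^{*}) & \frac{i}{2}(S-S^{*}) \\ \frac{i}{2}(S-S^{*}) & \mathbf{1} - \frac{1}{2}(S+S^{*}) \end{pmatrix}$. -/
noncomputable section

variable (E : Type*) [NormedAddCommGroup E] [InnerProductSpace ℂ E] [FiniteDimensional ℂ E]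

variable {E}

/-- The operator on `Ê = E ⊕ E` with the block decomposition
`(x, y) ↦ (P₁₁x + P₁₂y, P₂₁x + P₂₂y)`. -/
def blockOp (P11 P12 P21 P22 : E →ₗ[ℂ] E) : Ehat E →ₗ[ℂ] Ehat E :=
  toHat.toLinearMap ∘ₗ
    (LinearMap.prod
      (P11 ∘ₗ LinearMap.fst ℂ E E + P12 ∘ₗ LinearMap.snd ℂ E E)
      (P21 ∘ₗ LinearMap.fst ℂ E E + P22 ∘ₗ LinearMap.snd ℂ E E)) ∘ₗ
      toHat.symm.toLinearMap

theorem lagSMap_apply {F : Type*} [NormedAddCommGroup F] [InnerProductSpace ℂ F]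
    (S : F →ₗ[ℂ] F) (x : F) :
    lagSMap S x = WithLp.toLp 2 (x + S x, -Complex.I • (x - S x)) := rfl

theorem blockOp_apply {F : Type*} [NormedAddCommGroup F] [InnerProductSpace ℂ F]
    (P11 P12 P21 P22 : F →ₗ[ℂ] F) (v : Ehat F) :
    blockOp P11 P12 P21 P22 v =
      WithLp.toLp 2 (P11 v.fst + P12 v.snd, P21 v.fst + P22 v.snd) := rfl

theorem adjoint_lagSMap_apply (S : E →ₗ[ℂ] E) (v : Ehat E) :
    LinearMap.adjoint (lagSMap S) v =
      v.fst + star S v.fst + Complex.I • (v.snd - star S v.snd) := by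
  refine ext_inner_right ℂ fun x => ?_
  rw [LinearMap.adjoint_inner_left, lagSMap_apply, WithLp.prod_inner_apply]
  simp only [LinearMap.star_eq_adjoint, inner_add_left, inner_add_right, inner_sub_left,
    inner_sub_right, inner_smul_left, inner_smul_right, LinearMap.adjoint_inner_left,
    Complex.conj_I]
  rfl

theorem adjoint_lagSMap_comp_lagSMap {S : E →ₗ[ℂ] E} (hS : star S * S = 1) :
    LinearMap.adjoint (lagSMap S) ∘ₗ lagSMap S = (4 : ℂ) • 1 := by
  ext x
  have hx : star S (S x) = x := LinearMap.congr_fun hS x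
  simp only [LinearMap.comp_apply, adjoint_lagSMap_apply, lagSMap_apply, WithLp.toLp_fst,
    WithLp.toLp_snd, map_add, map_sub,
    map_smul, hx, LinearMap.smul_apply, Module.End.one_apply]
  match_scalars <;> grind [Complex.I_sq]

theorem blockOp_eq_lagSMap_comp_adjoint {S : E →ₗ[ℂ] E} (hS : S * star S = 1) :
    (2⁻¹ : ℂ) • blockOp
        (1 + (2⁻¹ : ℂ) • (S + star S)) ((Complex.I / 2) • (S - star S))
        ((Complex.I / 2) • (S - star S)) (1 - (2⁻¹ : ℂ) • (S + star S)) =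
      (4⁻¹ : ℂ) • (lagSMap S ∘ₗ LinearMap.adjoint (lagSMap S)) := by
  refine LinearMap.ext fun v => ?_
  have hx (x : E) : S (star S x) = x := LinearMap.congr_fun hS x
  rw [LinearMap.smul_apply, LinearMap.smul_apply, LinearMap.comp_apply, lagSMap_apply,
    adjoint_lagSMap_apply, blockOp_apply, ← WithLp.toLp_smul, ← WithLp.toLp_smul,
    Prod.smul_mk, Prod.smul_mk]
  simp only [map_add, map_sub, map_smul, hx, LinearMap.add_apply, LinearMap.sub_apply,
    LinearMap.smul_apply, Module.End.one_apply]
  congr 2 <;> match_scalars <;> grind [Complex.I_sq]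

/-- For a unitary operator `S` on `E`, the operator on `E ⊕ E` given in
block form by
`(1/2) [[1 + (S + S*)/2 , (i/2)(S - S*)], [(i/2)(S - S*), 1 - (S + S*)/2]]`
is the orthogonal projection onto the hermitian lagrangian `ℒ_S`, i.e. it is an idempotent,
self-adjoint operator with range `ℒ_S`. -/
theorem orthogonalProjection_lagS (S : E →ₗ[ℂ] E) (hS : S ∈ unitary (E →ₗ[ℂ] E)) :
    letI P : Ehat E →ₗ[ℂ] Ehat E :=
      (2⁻¹ : ℂ) • blockOp
        (1 + (2⁻¹ : ℂ) • (S + star S)) ((Complex.I / 2) • (S - star S))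
        ((Complex.I / 2) • (S - star S)) (1 - (2⁻¹ : ℂ) • (S + star S))
    P * P = P ∧ IsSelfAdjoint P ∧ LinearMap.range P = LagS S := by
  rw [blockOp_eq_lagSMap_comp_adjoint (Unitary.mul_star_self_of_mem hS)]
  have hA := adjoint_lagSMap_comp_lagSMap (Unitary.star_mul_self_of_mem hS)
  have hA' (x : E) : LinearMap.adjoint (lagSMap S) (lagSMap S x) = (4 : ℂ) • x :=
    LinearMap.congr_fun hA x
  refine ⟨?_, ?_, ?_⟩
  · refine LinearMap.ext fun v => ?_
    simp only [Module.End.mul_apply, LinearMap.smul_apply, LinearMap.comp_apply, map_smul, hA']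
    module
  · rw [LinearMap.isSelfAdjoint_iff', map_smulₛₗ, LinearMap.adjoint_comp,
      LinearMap.adjoint_adjoint]
    simp [Complex.conj_ofNat]
  · change _ = LinearMap.range (lagSMap S)
    rw [LinearMap.range_smul _ _ (by norm_num)]
    refine le_antisymm (LinearMap.range_comp_le_range _ _) ?_
    rintro _ ⟨x, rfl⟩
    refine ⟨lagSMap S ((4⁻¹ : ℂ) • x), ?_⟩
    rw [LinearMap.comp_apply, hA', smul_inv_smul₀ (by norm_num)]
end
end

section
/- Let $E$ be a finite-dimensional complex inner product space, $A : E \to E$ self-adjoint, $\widehat{A} := A \oplus (-A)$ the block-diagonal operator on $E \oplus E$, and $S$ a unitary operator on $E$. Then $\operatorname{Re}\operatorname{tr}\big(\widehat{A}\, P_{\mathcal{L}_S}\big) = \operatorname{Re}\operatorname{tr}(AS)$, where $P_{\mathcal{L}_S}$ is the orthogonal projection of $E \oplus E$ onto $\mathcal{L}_S$. (That is, the function $\varphi_A(L) = \operatorname{Re}\operatorname{tr}(\widehat{A}P_L)$ on hermitian lagrangians corresponds under $S \mapsto \mathcal{L}_S$ to $f_A(S) = \operatorname{Re}\operatorname{tr}(AS)$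 on the unitary group.) -/
noncomputable section

variable (E : Type*) [NormedAddCommGroup E] [InnerProductSpace ℂ E] [FiniteDimensional ℂ E]

variable {E}

/-- The block-diagonal operator `Â = A ⊕ (-A)` on `Ê = E ⊕ E`. -/
def Ahat (A : E →ₗ[ℂ] E) : Ehat E →ₗ[ℂ] Ehat E :=
  toHat.toLinearMap ∘ₗ (LinearMap.prodMap A (-A)) ∘ₗ toHat.symm.toLinearMap

/-- The parametrization `x ↦ ((1+S)x, -i(1-S)x)` of `ℒ_S`. -/
def lagParam (S : E →ₗ[ℂ] E) : E →ₗ[ℂ] Ehat E :=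
  toHat.toLinearMap ∘ₗ LinearMap.prod (1 + S) ((-Complex.I) • (1 - S))

lemma adjoint_lagParam_toHat (S : E →ₗ[ℂ] E) (u v : E) :
    LinearMap.adjoint (lagParam S) (toHat (u, v)) =
      u + LinearMap.adjoint S u + Complex.I • (v - LinearMap.adjoint S v) := by
  refine ext_inner_right ℂ fun x => ?_
  rw [LinearMap.adjoint_inner_left]
  simp [lagParam, toHat, WithLp.prod_inner_apply, inner_add_left, inner_add_right,
    inner_sub_left, inner_sub_right, inner_smul_left, inner_smul_right,
    LinearMap.adjoint_inner_left]

lemma adjoint_apply_apply_of_mem_unitary {S : E →ₗ[ℂ] E} (hS : S ∈ unitary (E →ₗ[ℂ] E)) (x : E) :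
    LinearMap.adjoint S (S x) = x :=
  LinearMap.congr_fun (Unitary.star_mul_self_of_mem hS) x

lemma adjoint_lagParam_lagParam {S : E →ₗ[ℂ] E} (hS : S ∈ unitary (E →ₗ[ℂ] E)) (x : E) :
    LinearMap.adjoint (lagParam S) (lagParam S x) = (4 : ℂ) • x := by
  have h : lagParam S x = toHat (x + S x, (-Complex.I) • (x - S x)) := rfl
  rw [h, adjoint_lagParam_toHat]
  simp only [map_add, map_sub, map_smul, adjoint_apply_apply_of_mem_unitary hS, ← smul_sub,
    smul_smul]
  simp only [mul_neg, Complex.I_mul_I]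
  module

/-- The orthogonal projection onto `ℒ_S` is `T T* / 4`, where `T` parametrizes `ℒ_S`. -/
lemma four_smul_proj_eq {S : E →ₗ[ℂ] E} (hS : S ∈ unitary (E →ₗ[ℂ] E))
    {P : Ehat E →ₗ[ℂ] Ehat E} (hP1 : P * P = P) (hP2 : IsSelfAdjoint P)
    (hP3 : LinearMap.range P = LagS S) :
    (4 : ℂ) • P = lagParam S ∘ₗ LinearMap.adjoint (lagParam S) := by
  have hPT (x : E) : P (lagParam S x) = lagParam S x := by
    have hx : lagParam S x ∈ LinearMap.range P := hP3 ▸ LinearMap.mem_range_self (lagParam S) x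
    obtain ⟨w, hw⟩ := hx
    rw [← hw]
    exact LinearMap.congr_fun hP1 w
  have hTP (w : Ehat E) :
      LinearMap.adjoint (lagParam S) (P w) = LinearMap.adjoint (lagParam S) w := by
    refine ext_inner_right ℂ fun x => ?_
    rw [LinearMap.adjoint_inner_left, LinearMap.adjoint_inner_left,
      ← LinearMap.adjoint_inner_right, LinearMap.isSelfAdjoint_iff'.mp hP2, hPT]
  ext1 w
  have hw : P w ∈ LagS S := hP3 ▸ LinearMap.mem_range_self P w
  obtain ⟨y, hy⟩ : ∃ y, lagParam S y = P w := hw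
  rw [LinearMap.comp_apply, ← hTP, ← hy, adjoint_lagParam_lagParam hS, map_smul,
    LinearMap.smul_apply, hy]

lemma adjoint_lagParam_comp_Ahat_comp_lagParam (A S : E →ₗ[ℂ] E) :
    LinearMap.adjoint (lagParam S) ∘ₗ Ahat A ∘ₗ lagParam S =
      (2 : ℂ) • (A * S + LinearMap.adjoint S * A) := by
  ext1 x
  have h : Ahat A (lagParam S x) = toHat (A (x + S x), -A ((-Complex.I) • (x - S x))) := rfl
  rw [LinearMap.comp_apply, LinearMap.comp_apply, h, adjoint_lagParam_toHat]
  simp only [map_add, map_sub, map_smul, map_neg, LinearMap.smul_apply, LinearMap.add_apply,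
    Module.End.mul_apply, neg_smul, neg_neg, ← smul_sub, smul_smul, Complex.I_mul_I]
  module

lemma trace_adjoint_eq_conj (B : E →ₗ[ℂ] E) :
    LinearMap.trace ℂ E (LinearMap.adjoint B) = starRingEnd ℂ (LinearMap.trace ℂ E B) := by
  let b := stdOrthonormalBasis ℂ E
  rw [LinearMap.trace_eq_sum_inner _ b, LinearMap.trace_eq_sum_inner _ b, map_sum]
  simp [LinearMap.adjoint_inner_right]

/-- For `A` self-adjoint on `E`, `Â = A ⊕ (-A)`, and `S` unitary, the
orthogonal projection `P` of `E ⊕ E` onto `ℒ_S` (characterized by `P² = P = P*` and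
`range P = ℒ_S`) satisfies `Re tr(Â P) = Re tr(A S)`. -/
theorem re_trace_Ahat_proj (A : E →ₗ[ℂ] E) (hA : IsSelfAdjoint A)
    (S : E →ₗ[ℂ] E) (hS : S ∈ unitary (E →ₗ[ℂ] E))
    (P : Ehat E →ₗ[ℂ] Ehat E) (hP1 : P * P = P) (hP2 : IsSelfAdjoint P)
    (hP3 : LinearMap.range P = LagS S) :
    (LinearMap.trace ℂ (Ehat E) (Ahat A * P)).re = (LinearMap.trace ℂ E (A * S)).re := by
  have hadj : LinearMap.adjoint S * A = LinearMap.adjoint (A * S) := by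
    change _ = star (A * S)
    rw [star_mul, hA.star_eq]
    rfl
  have htr : (4 : ℂ) * LinearMap.trace ℂ (Ehat E) (Ahat A * P) =
      2 * (LinearMap.trace ℂ E (A * S) + starRingEnd ℂ (LinearMap.trace ℂ E (A * S))) := by
    have h4 : (4 : ℂ) • (Ahat A * P) =
        (Ahat A ∘ₗ lagParam S) ∘ₗ LinearMap.adjoint (lagParam S) := by
      rw [← mul_smul_comm, four_smul_proj_eq hS hP1 hP2 hP3]
      rfl
    have h := congrArg (LinearMap.trace ℂ (Ehat E)) h4
    rwa [LinearMap.trace_comp_comm', adjoint_lagParam_comp_Ahat_comp_lagParam, map_smul, map_smul,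
      map_add, hadj, trace_adjoint_eq_conj, smul_eq_mul, smul_eq_mul] at h
  have hre := congrArg Complex.re htr
  simp at hre
  linarith
end
end

section
/- Let $0 < \alpha_1 < \cdots < \alpha_n$ be real numbers and $A = \operatorname{diag}(\alpha_1,\dots,\alpha_n)$ as an $n \times n$ complex matrix. For a unitary matrix $S \in U(n)$ the following are equivalent: (i) $\operatorname{Re}\operatorname{tr}(ASX) = 0$ for every skew-hermitian matrix $X$ (i.e., $S$ is a critical point of the function $f_A(S) = \operatorname{Re}\operatorname{tr}(AS)$ on the unitary group); (ii) $SAS = A$; (iii) $S$ is a diagonal matrix all of whose diagonal entries lie in $\{1,-1\}$ (in particular $S = S^{*}$, $S^2 = \mathbf{1}$ and $SA = AS$). -/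
open Matrix

open scoped ComplexOrder in
/-- A complex matrix whose real trace pairing with every skew-hermitian matrix vanishes is
hermitian. -/
theorem Matrix.isHermitian_of_forall_re_trace_mul_eq_zero {n : Type*} [Fintype n]
    {B : Matrix n n ℂ} (h : ∀ X : Matrix n n ℂ, Xᴴ = -X → ((B * X).trace).re = 0) :
    B.IsHermitian := by
  have hX : (B - Bᴴ)ᴴ = -(B - Bᴴ) := by simp
  have hre := h _ hX
  have hstar : (Bᴴ * (B - Bᴴ)).trace = -star ((B * (B - Bᴴ)).trace) := by
    rw [← trace_conjTranspose, conjTranspose_mul, hX, neg_mul, trace_neg, neg_neg,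
      trace_mul_comm]
  have hzero : ((B - Bᴴ)ᴴ * (B - Bᴴ)).trace = 0 := by
    apply Complex.ext
    · rw [hX, neg_mul, sub_mul, trace_neg, trace_sub, hstar]
      simp [hre]
    · have him := congrArg Complex.im (trace_conjTranspose ((B - Bᴴ)ᴴ * (B - Bᴴ)))
      rw [conjTranspose_mul, conjTranspose_conjTranspose, Complex.star_def,
        Complex.conj_im] at him
      simp only [Complex.zero_im]
      linarith
  exact (sub_eq_zero.mp (trace_conjTranspose_mul_self_eq_zero_iff.mp hzero)).symm

/-- If a unitary `S` satisfies `S * A * S = A`, then `S` commutes with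
`A * A`. -/
theorem Matrix.commute_mul_self_of_mul_mul_eq {n : Type*} [Fintype n] [DecidableEq n]
    {S A : Matrix n n ℂ} (hS : S ∈ unitaryGroup n ℂ) (h : S * A * S = A) :
    Commute S (A * A) := by
  have hleft : A * S = Sᴴ * A := by
    have h' := congrArg (Sᴴ * ·) h
    simpa [← mul_assoc, ← star_eq_conjTranspose, mem_unitaryGroup_iff'.mp hS] using h'
  have hright : S * A = A * Sᴴ := by
    have h' := congrArg (· * Sᴴ) h
    simpa [mul_assoc, ← star_eq_conjTranspose, mem_unitaryGroup_iff.mp hS] using h'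
  calc S * (A * A) = A * (Sᴴ * A) := by rw [← mul_assoc, hright, mul_assoc]
    _ = A * A * S := by rw [← hleft, mul_assoc]

/-- Let `0 < α₁ < ⋯ < αₙ` and `A = diag(α₁, …, αₙ)`. For a unitary matrix
`S ∈ U(n)` the following are equivalent: (i) `Re tr(ASX) = 0` for every skew-hermitian `X`
(`S` is a critical point of `f_A(S) = Re tr(AS)`); (ii) `SAS = A`; (iii) `S` is diagonal with
all diagonal entries in `{1, -1}`. -/
theorem critical_points_of_trace_functional {n : ℕ} (α : Fin n → ℝ)
    (hpos : ∀ i, 0 < α i) (hmono : StrictMono α)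
    (S : Matrix (Fin n) (Fin n) ℂ) (hS : S ∈ Matrix.unitaryGroup (Fin n) ℂ) :
    List.TFAE [
      ∀ X : Matrix (Fin n) (Fin n) ℂ, Xᴴ = -X →
        ((Matrix.diagonal (fun i => (α i : ℂ)) * S * X).trace).re = 0,
      S * Matrix.diagonal (fun i => (α i : ℂ)) * S = Matrix.diagonal (fun i => (α i : ℂ)),
      ∃ d : Fin n → ℂ, (∀ i, d i = 1 ∨ d i = -1) ∧ S = Matrix.diagonal d] := by
  tfae_have 1 → 2 := by
    intro h
    have hB := isHermitian_of_forall_re_trace_mul_eq_zero h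
    have hA : (diagonal (fun i => (α i : ℂ)))ᴴ = diagonal (fun i => (α i : ℂ)) := by
      simp [diagonal_conjTranspose, Pi.star_def]
    rw [IsHermitian, conjTranspose_mul, hA] at hB
    rw [mul_assoc, ← hB, ← mul_assoc, ← star_eq_conjTranspose, mem_unitaryGroup_iff.mp hS,
      one_mul]
  tfae_have 2 → 3 := by
    intro h
    have hcomm := (commute_mul_self_of_mul_mul_eq hS h).eq
    have hoff : ∀ i j, i ≠ j → S i j = 0 := by
      intro i j hij
      have hentry := congrFun (congrFun hcomm i) j
      rw [diagonal_mul_diagonal, mul_diagonal, diagonal_mul] at hentry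
      have hsq : (α j : ℂ) * α j - α i * α i ≠ 0 := by
        rw [sub_ne_zero]
        norm_cast
        rw [mul_self_inj (hpos j).le (hpos i).le]
        exact fun hji => hij (hmono.injective hji).symm
      refine (mul_eq_zero.mp (?_ : S i j * ((α j : ℂ) * α j - α i * α i) = 0)).resolve_right hsq
      linear_combination hentry
    have hdiag : S = diagonal S.diag :=
      (IsDiag.diagonal_diag fun i j hij => hoff i j hij).symm
    refine ⟨S.diag, fun i => ?_, hdiag⟩
    rw [hdiag, diagonal_mul_diagonal, diagonal_mul_diagonal] at h
    have hi := congrFun (diagonal_injective h) i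
    have hα : (α i : ℂ) ≠ 0 := by exact_mod_cast (hpos i).ne'
    rw [← mul_self_eq_one_iff]
    apply mul_right_cancel₀ hα
    linear_combination hi
  tfae_have 3 → 1 := by
    rintro ⟨d, hd, rfl⟩ X hX
    rw [diagonal_mul_diagonal, trace, Complex.re_sum]
    refine Finset.sum_eq_zero fun i _ => ?_
    have hXi : (X i i).re = 0 := by
      have hre := congrArg Complex.re (congrFun (congrFun hX i) i)
      simp only [conjTranspose_apply, Complex.star_def, Complex.conj_re, Matrix.neg_apply,
        Complex.neg_re] at hre
      linarith
    rcases hd i with hi | hi <;> simp [diagonal_mul, hi, hXi]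
  tfae_finish
end

section
/- Let $K, M \subseteq \{1,\dots,n\}$. The following are equivalent: (i) $K \vartriangleleft M$ and $\boldsymbol{w}(K) = \boldsymbol{w}(M) + 1$; (ii) $1 \in K$ and $M = K \setminus \{1\}$. (Via the dictionary $K \vartriangleleft M \iff W_K^- \subseteq \operatorname{cl}(W_M^-)$ and $\dim W_I^- = n^2 - \boldsymbol{w}(I)$, this says: $W_K^-$ lies in the closure of $W_M^-$ with $\dim W_K^- = \dim W_M^- - 1$ iff $1 \in K$ and $M = K\setminus\{1\}$.) -/
open Finset

/-- `ν_K ℓ` is the `ℓ`-th largest element of `K` (`0`-based: `ν_K 0` is the largest element,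
corresponding to `ν_K(1)` in the paper). -/
def nuDec (K : Finset ℕ) (ℓ : Fin K.card) : ℕ :=
  K.orderEmbOfFin rfl ⟨K.card - 1 - (ℓ : ℕ), by have := ℓ.isLt; omega⟩

/-- The relation `J ◁ I`: either `I = ∅`, or `#J ≥ #I` and `ν_I(ℓ) ≤ ν_J(ℓ)` for every
`1 ≤ ℓ ≤ #I`. -/
def TriLT (J I : Finset ℕ) : Prop :=
  I = ∅ ∨ ∃ h : I.card ≤ J.card, ∀ ℓ : Fin I.card, nuDec I ℓ ≤ nuDec J (Fin.castLE h ℓ)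

/-- The weight `w(I) = ∑_{i ∈ I} (2i - 1)`. -/
def wtN (I : Finset ℕ) : ℕ := ∑ i ∈ I, (2 * i - 1)

theorem nuDec_strictAnti (K : Finset ℕ) : StrictAnti (nuDec K) := by
  intro a b hab
  refine (K.orderEmbOfFin rfl).strictMono ?_
  have := a.isLt
  have := b.isLt
  rw [Fin.lt_def] at hab ⊢
  dsimp only
  omega

theorem nuDec_mem (K : Finset ℕ) (ℓ : Fin K.card) : nuDec K ℓ ∈ K :=
  K.orderEmbOfFin_mem rfl _

theorem image_nuDec (K : Finset ℕ) : univ.image (nuDec K) = K := by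
  refine eq_of_subset_of_card_le (fun x hx => ?_) ?_
  · obtain ⟨ℓ, -, rfl⟩ := mem_image.1 hx
    exact nuDec_mem K ℓ
  · rw [card_image_of_injective _ (nuDec_strictAnti K).injective, card_univ, Fintype.card_fin]

theorem wtN_image {m : ℕ} {g : Fin m → ℕ} (hg : Function.Injective g) :
    wtN (univ.image g) = ∑ ℓ, (2 * g ℓ - 1) :=
  sum_image hg.injOn

theorem triLT_of_subset {K M : Finset ℕ} (h : M ⊆ K) : TriLT K M := by
  refine Or.inr ⟨card_le_card h, fun ℓ => ?_⟩
  by_contra! hlt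
  have hsub : (Iic ℓ).image (nuDec M) ⊆
      (Iio (Fin.castLE (card_le_card h) ℓ)).image (nuDec K) := by
    intro x hx
    obtain ⟨j, hj, rfl⟩ := mem_image.1 hx
    have hjK := h (nuDec_mem M j)
    rw [← image_nuDec K] at hjK
    obtain ⟨i, -, hi⟩ := mem_image.1 hjK
    refine mem_image.2 ⟨i, mem_Iio.2 ?_, hi⟩
    rw [← (nuDec_strictAnti K).lt_iff_gt, hi]
    exact hlt.trans_le ((nuDec_strictAnti M).antitone (mem_Iic.1 hj))
  have hcard := card_le_card hsub
  rw [card_image_of_injective _ (nuDec_strictAnti M).injective,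
    card_image_of_injective _ (nuDec_strictAnti K).injective, Fin.card_Iic, Fin.card_Iio,
    Fin.val_castLE] at hcard
  omega

theorem eq_singleton_of_wtN_eq_one {R : Finset ℕ} (hpos : ∀ x ∈ R, 1 ≤ x) (h : wtN R = 1) :
    R = {1} := by
  have hone : ∀ x ∈ R, x = 1 := by
    intro x hx
    have hle : 2 * x - 1 ≤ wtN R :=
      single_le_sum (f := fun i => 2 * i - 1) (fun _ _ => Nat.zero_le _) hx
    have := hpos x hx
    omega
  refine eq_singleton_iff_nonempty_unique_mem.2 ⟨?_, hone⟩
  rw [nonempty_iff_ne_empty]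
  rintro rfl
  simp [wtN] at h

/-- If `K ◁ M`, the `#M` largest elements of `K` form a set whose weight exceeds that of `M` by an
even number, which vanishes only if this set is `M`. -/
theorem TriLT.exists_subset {K M : Finset ℕ} (hM : ∀ x ∈ M, 1 ≤ x) (h : TriLT K M) :
    ∃ J ⊆ K, ∃ d : ℕ, wtN J = wtN M + 2 * d ∧ (d = 0 → J = M) := by
  rcases h with rfl | ⟨hc, hle⟩
  · exact ⟨∅, empty_subset K, 0, rfl, fun _ => rfl⟩
  set g : Fin M.card → ℕ := fun ℓ => nuDec K (Fin.castLE hc ℓ)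
  have hinj : Function.Injective g :=
    (nuDec_strictAnti K).injective.comp (Fin.castLE_injective hc)
  refine ⟨univ.image g, fun x hx => ?_, ∑ ℓ, (g ℓ - nuDec M ℓ), ?_, fun hd => ?_⟩
  · obtain ⟨ℓ, -, rfl⟩ := mem_image.1 hx
    exact nuDec_mem K _
  · have hwM := wtN_image (nuDec_strictAnti M).injective
    rw [image_nuDec] at hwM
    rw [wtN_image hinj, hwM, mul_sum, ← sum_add_distrib]
    refine sum_congr rfl fun ℓ _ => ?_
    have h1 : nuDec M ℓ ≤ g ℓ := hle ℓ
    have h2 := hM _ (nuDec_mem M ℓ)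
    omega
  · have hgM : g = nuDec M := by
      funext ℓ
      have h1 : nuDec M ℓ ≤ g ℓ := hle ℓ
      have h2 := sum_eq_zero_iff.1 hd ℓ (mem_univ ℓ)
      omega
    rw [hgM, image_nuDec]

/-- For `K, M ⊆ {1, …, n}`: `K ◁ M` and `w(K) = w(M) + 1` if and only
if `1 ∈ K` and `M = K \ {1}`; i.e. `W_K⁻` lies in the closure of `W_M⁻` with
`dim W_K⁻ = dim W_M⁻ - 1` iff `1 ∈ K` and `M = K \ {1}`. -/
theorem triLT_codim_one {n : ℕ} (K M : Finset ℕ)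
    (hK : K ⊆ Finset.Icc 1 n) (hM : M ⊆ Finset.Icc 1 n) :
    (TriLT K M ∧ wtN K = wtN M + 1) ↔ (1 ∈ K ∧ M = K.erase 1) := by
  constructor
  · rintro ⟨hT, hw⟩
    obtain ⟨J, hJK, d, hd, hJM⟩ := hT.exists_subset fun x hx => (mem_Icc.1 (hM hx)).1
    have hsum : wtN (K \ J) + wtN J = wtN K := sum_sdiff hJK
    obtain rfl := hJM (by omega)
    have hR : K \ J = {1} :=
      eq_singleton_of_wtN_eq_one (fun x hx => (mem_Icc.1 (hK (mem_sdiff.1 hx).1)).1) (by omega)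
    refine ⟨(mem_sdiff.1 (hR ▸ mem_singleton_self 1)).1, ?_⟩
    rw [← sdiff_singleton_eq_erase, ← hR, Finset.sdiff_sdiff_eq_self hJK]
  · rintro ⟨h1, rfl⟩
    exact ⟨triLT_of_subset (erase_subset 1 K),
      (sum_erase_add K (fun i => 2 * i - 1) h1).symm⟩
end

section
/- Let $K, M \subseteq \{1,\dots,n\}$. The following are equivalent: (i) $K \vartriangleleft M$ and $\boldsymbol{w}(K) = \boldsymbol{w}(M) + 2$; (ii) $\#K = \#M$, $\#(K \cap M) = \#K - 1$, and there exists $i \in \{1,\dots,n-1\}$ such that $K = (K \cap M) \cup \{i+1\}$ and $M = (K \cap M) \cup \{i\}$. (Via the dictionary $K \vartriangleleft M \iff W_K^- \subseteq \operatorname{cl}(W_M^-)$ and $\dim W_I^- = n^2 - \boldsymbol{w}(I)$, this characterizes when $W_K^-$ lies in the closure of $W_M^-$ with $\dim W_K^- = \dim W_M^- - 2$.) -/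
open Finset

/-- The number of elements of `I` that are at least `t`. -/
def cardGE (I : Finset ℕ) (t : ℕ) : ℕ := #{x ∈ I | t ≤ x}

theorem le_nuDec_iff (I : Finset ℕ) (ℓ : Fin I.card) (t : ℕ) :
    t ≤ nuDec I ℓ ↔ (ℓ : ℕ) < cardGE I t := by
  have hℓ := ℓ.isLt
  unfold nuDec cardGE
  set j : Fin I.card := ⟨I.card - 1 - (ℓ : ℕ), by omega⟩ with hj
  constructor
  · intro h
    have hsub : (Finset.Ici j).map (I.orderEmbOfFin rfl).toEmbedding ⊆ {x ∈ I | t ≤ x} := by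
      intro x hx
      obtain ⟨m, hm, rfl⟩ := Finset.mem_map.1 hx
      refine Finset.mem_filter.2 ⟨I.orderEmbOfFin_mem rfl m, h.trans ?_⟩
      exact (I.orderEmbOfFin rfl).monotone (Finset.mem_Ici.1 hm)
    have hc := Finset.card_le_card hsub
    rw [Finset.card_map, Fin.card_Ici] at hc
    simp only [hj] at hc
    omega
  · contrapose!
    intro h
    have hsub : ({x ∈ I | t ≤ x} : Finset ℕ) ⊆
        (Finset.Ioi j).map (I.orderEmbOfFin rfl).toEmbedding := by
      intro x hx
      obtain ⟨hxI, htx⟩ := Finset.mem_filter.1 hx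
      rw [← Finset.mem_coe, ← I.range_orderEmbOfFin rfl] at hxI
      obtain ⟨m, rfl⟩ := hxI
      exact Finset.mem_map.2 ⟨m, Finset.mem_Ioi.2
        ((I.orderEmbOfFin rfl).lt_iff_lt.1 (h.trans_le htx)), rfl⟩
    have hc := Finset.card_le_card hsub
    rw [Finset.card_map, Fin.card_Ioi] at hc
    simp only [hj] at hc
    omega

theorem cardGE_zero (I : Finset ℕ) : cardGE I 0 = I.card := by
  simp [cardGE]

theorem cardGE_le_card (I : Finset ℕ) (t : ℕ) : cardGE I t ≤ I.card :=
  Finset.card_filter_le _ _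

theorem triLT_iff_cardGE_le (K M : Finset ℕ) :
    TriLT K M ↔ ∀ t, cardGE M t ≤ cardGE K t := by
  constructor
  · rintro (rfl | ⟨h, hle⟩) t
    · simp [cardGE]
    · by_contra! hlt
      have hM := cardGE_le_card M t
      have h1 := (le_nuDec_iff M ⟨cardGE K t, by omega⟩ t).2 hlt
      have h2 := (le_nuDec_iff K _ t).1 (h1.trans (hle _))
      simp at h2
  · intro h
    have h0 := h 0
    rw [cardGE_zero, cardGE_zero] at h0
    refine Or.inr ⟨h0, fun ℓ => (le_nuDec_iff K _ _).2 ?_⟩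
    exact ((le_nuDec_iff M ℓ _).1 le_rfl).trans_le (h _)

theorem cardGE_eq_succ (I : Finset ℕ) (t : ℕ) :
    cardGE I t = cardGE I (t + 1) + if t ∈ I then 1 else 0 := by
  unfold cardGE
  split_ifs with ht
  · rw [← Finset.card_insert_of_notMem (a := t) (by simp)]
    congr 1
    ext x
    simp only [Finset.mem_filter, Finset.mem_insert]
    grind
  · congr 1
    ext x
    simp only [Finset.mem_filter]
    grind

theorem cardGE_insert {C : Finset ℕ} {a : ℕ} (ha : a ∉ C) (t : ℕ) :
    cardGE (insert a C) t = cardGE C t + if t ≤ a then 1 else 0 := by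
  unfold cardGE
  rw [Finset.filter_insert]
  split_ifs with h
  · rw [Finset.card_insert_of_notMem (by simp [ha])]
  · rfl

theorem sum_eq_sum_cardGE {I : Finset ℕ} {N : ℕ} (hI : ∀ x ∈ I, x ≤ N) :
    ∑ x ∈ I, x = ∑ t ∈ Finset.range N, cardGE I (t + 1) := by
  simp only [cardGE, Finset.card_filter]
  rw [Finset.sum_comm]
  refine Finset.sum_congr rfl fun x hx => ?_
  have hx := hI x hx
  rw [← Finset.card_filter]
  have : ({t ∈ Finset.range N | t + 1 ≤ x} : Finset ℕ) = Finset.range x := by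
    ext t
    simp only [Finset.mem_filter, Finset.mem_range]
    omega
  rw [this, Finset.card_range]

theorem wtN_add_card {I : Finset ℕ} (hI : ∀ x ∈ I, 1 ≤ x) :
    wtN I + I.card = 2 * ∑ x ∈ I, x := by
  rw [wtN, Finset.card_eq_sum_ones, ← Finset.sum_add_distrib, Finset.mul_sum]
  refine Finset.sum_congr rfl fun x hx => ?_
  have := hI x hx
  omega

/-- Two pointwise comparable functions whose sums over `s` differ by one
differ at exactly one point of `s`, and there by one. -/
theorem exists_eq_add_one_of_sum_eq_add_one {s : Finset ℕ} {f g : ℕ → ℕ}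
    (hle : ∀ t ∈ s, f t ≤ g t) (hsum : ∑ t ∈ s, g t = ∑ t ∈ s, f t + 1) :
    ∃ a ∈ s, g a = f a + 1 ∧ ∀ t ∈ s, t ≠ a → g t = f t := by
  obtain ⟨a, ha, hlt⟩ : ∃ a ∈ s, f a < g a := Finset.exists_lt_of_sum_lt (by omega)
  have hle' : ∀ t ∈ s.erase a, f t ≤ g t := fun t ht => hle t (Finset.mem_of_mem_erase ht)
  have hf := Finset.add_sum_erase s f ha
  have hg := Finset.add_sum_erase s g ha
  have hs := Finset.sum_le_sum hle'
  refine ⟨a, ha, by omega, fun t ht hta => ?_⟩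
  exact ((Finset.sum_eq_sum_iff_of_le hle').1 (by omega) t
    (Finset.mem_erase.2 ⟨hta, ht⟩)).symm

theorem card_eq_of_cardGE_le {K M : Finset ℕ} (hK : ∀ x ∈ K, 1 ≤ x) (hM : ∀ x ∈ M, 1 ≤ x)
    (hle : ∀ t, cardGE M t ≤ cardGE K t) (hw : wtN K = wtN M + 2) : K.card = M.card := by
  obtain ⟨N, hN⟩ : ∃ N, ∀ x ∈ K ∪ M, x ≤ N :=
    ⟨(K ∪ M).sup id, fun x hx => Finset.le_sup (f := id) hx⟩
  have hsK := sum_eq_sum_cardGE (I := K) (N := N + 2)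
    fun x hx => (hN x (Finset.mem_union_left _ hx)).trans (by omega)
  have hsM := sum_eq_sum_cardGE (I := M) (N := N + 2)
    fun x hx => (hN x (Finset.mem_union_right _ hx)).trans (by omega)
  rw [Finset.sum_range_succ', Finset.sum_range_succ'] at hsK hsM
  have hrest := Finset.sum_le_sum fun t (_ : t ∈ Finset.range N) => hle (t + 1 + 1 + 1)
  have hwK := wtN_add_card hK
  have hwM := wtN_add_card hM
  have h0 := hle 0
  have hK0 := cardGE_eq_succ K 0
  have hM0 := cardGE_eq_succ M 0
  have hK1 := cardGE_eq_succ K 1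
  have hM1 := cardGE_eq_succ M 1
  rw [if_neg fun h => by simpa using hK 0 h] at hK0
  rw [if_neg fun h => by simpa using hM 0 h] at hM0
  rw [cardGE_zero] at hK0 hM0
  rw [cardGE_zero, cardGE_zero] at h0
  simp only [zero_add, Nat.reduceAdd] at *
  split_ifs at hK1 hM1 <;> omega

theorem exists_insert_succ_of_cardGE_le {K M : Finset ℕ} (hK : ∀ x ∈ K, 1 ≤ x)
    (hM : ∀ x ∈ M, 1 ≤ x) (hle : ∀ t, cardGE M t ≤ cardGE K t) (hw : wtN K = wtN M + 2) :
    ∃ i ∈ M, i ∉ K ∧ i + 1 ∈ K ∧ i + 1 ∉ M ∧ ∀ x, x ≠ i → x ≠ i + 1 → (x ∈ K ↔ x ∈ M) := by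
  have hcard := card_eq_of_cardGE_le hK hM hle hw
  obtain ⟨N, hN⟩ : ∃ N, ∀ x ∈ K ∪ M, x ≤ N :=
    ⟨(K ∪ M).sup id, fun x hx => Finset.le_sup (f := id) hx⟩
  have hNK : ∀ x ∈ K, x ≤ N := fun x hx => hN x (Finset.mem_union_left _ hx)
  have hNM : ∀ x ∈ M, x ≤ N := fun x hx => hN x (Finset.mem_union_right _ hx)
  have hsK := sum_eq_sum_cardGE hNK
  have hsM := sum_eq_sum_cardGE hNM
  have hwK := wtN_add_card hK
  have hwM := wtN_add_card hM
  obtain ⟨i, -, hi, hne⟩ := exists_eq_add_one_of_sum_eq_add_one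
    (s := Finset.range N) (f := fun t => cardGE M (t + 1)) (g := fun t => cardGE K (t + 1))
    (fun t _ => hle (t + 1)) (by omega)
  have heq : ∀ t, t ≠ i + 1 → cardGE K t = cardGE M t := by
    intro t ht
    rcases t with _ | t
    · simpa [cardGE_zero] using hcard
    · by_cases htN : t < N
      · exact hne t (Finset.mem_range.2 htN) (by omega)
      · have h (I : Finset ℕ) (hI : ∀ x ∈ I, x ≤ N) : cardGE I (t + 1) = 0 := by
          refine Finset.card_eq_zero.2 (Finset.filter_eq_empty_iff.2 fun x hx => ?_)
          have := hI x hx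
          omega
        rw [h K hNK, h M hNM]
  have hKi := cardGE_eq_succ K i
  have hMi := cardGE_eq_succ M i
  have hKi' := cardGE_eq_succ K (i + 1)
  have hMi' := cardGE_eq_succ M (i + 1)
  have h1 := heq i (by omega)
  have h2 := heq (i + 1 + 1) (by omega)
  refine ⟨i, ?_, ?_, ?_, ?_, fun x hx hx' => ?_⟩
  iterate 4 grind
  have hKx := cardGE_eq_succ K x
  have hMx := cardGE_eq_succ M x
  have h3 := heq x hx'
  have h4 := heq (x + 1) (by omega)
  grind

/-- For `K, M ⊆ {1, …, n}`: `K ◁ M` and `w(K) = w(M) + 2` if and only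
if `#K = #M`, `#(K ∩ M) = #K - 1`, and there is `i ∈ {1, …, n-1}` with
`K = (K ∩ M) ∪ {i+1}` and `M = (K ∩ M) ∪ {i}`. -/
theorem triLT_codim_two {n : ℕ} (K M : Finset ℕ)
    (hK : K ⊆ Finset.Icc 1 n) (hM : M ⊆ Finset.Icc 1 n) :
    (TriLT K M ∧ wtN K = wtN M + 2) ↔
      (K.card = M.card ∧ (K ∩ M).card = K.card - 1 ∧
        ∃ i, 1 ≤ i ∧ i ≤ n - 1 ∧
          K = insert (i + 1) (K ∩ M) ∧ M = insert i (K ∩ M)) := by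
  have hK1 : ∀ x ∈ K, 1 ≤ x := fun x hx => (Finset.mem_Icc.1 (hK hx)).1
  have hM1 : ∀ x ∈ M, 1 ≤ x := fun x hx => (Finset.mem_Icc.1 (hM hx)).1
  rw [triLT_iff_cardGE_le]
  constructor
  · rintro ⟨hle, hw⟩
    obtain ⟨i, hiM, hiK, hiK', hiM', hx⟩ := exists_insert_succ_of_cardGE_le hK1 hM1 hle hw
    have hKi : K = insert (i + 1) (K ∩ M) := by
      ext x
      have := hx x
      simp only [Finset.mem_insert, Finset.mem_inter]
      grind
    have hMi : M = insert i (K ∩ M) := by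
      ext x
      have := hx x
      simp only [Finset.mem_insert, Finset.mem_inter]
      grind
    have hn := (Finset.mem_Icc.1 (hK hiK')).2
    refine ⟨card_eq_of_cardGE_le hK1 hM1 hle hw, ?_, i, hM1 i hiM, by omega, hKi, hMi⟩
    have hc := congrArg Finset.card hKi
    rw [Finset.card_insert_of_notMem (by simp [hiM'])] at hc
    omega
  · rintro ⟨hcard, hinter, i, hi, -, hKi, hMi⟩
    have hpos : 0 < K.card := Finset.card_pos.2 ⟨i + 1, by rw [hKi]; simp⟩
    generalize K ∩ M = C at *
    have hKC : i + 1 ∉ C := by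
      intro h
      rw [Finset.insert_eq_of_mem h] at hKi
      subst hKi
      omega
    have hMC : i ∉ C := by
      intro h
      rw [Finset.insert_eq_of_mem h] at hMi
      subst hMi
      omega
    refine ⟨fun t => ?_, ?_⟩
    · rw [hKi, hMi, cardGE_insert hKC, cardGE_insert hMC]
      split_ifs <;> omega
    · rw [hKi, hMi, wtN, wtN, Finset.sum_insert hKC, Finset.sum_insert hMC]
      omega
end
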